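/- Every (K4^-, house, net)-free graph is partitionable: its vertex set can be partitioned into a set inducing a disjoint union of cliques and a set inducing a triangle-free graph. -/

import Mathlib

open SimpleGraph

variable {V : Type*}

/-- The set `B` induces a `P₃`-free graph (disjoint union of cliques). -/
def P3FreeOn (G : SimpleGraph V) (B : Set V) : Prop :=
  ∀ a ∈ B, ∀ b ∈ B, ∀ c ∈ B, G.Adj a b → G.Adj b c → a ≠ c → G.Adj a c

/-- The set `R` induces a triangle-free graph. -/
def K3FreeOn (G : SimpleGraph V) (R : Set V) : Prop :=
  ∀ a ∈ R, ∀ b ∈ R, ∀ c ∈ R, ¬(G.Adj a b ∧ G.Adj b c ∧ G.Adj a c)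

/-- A graph is partitionable if its vertices split into a `P₃`-free part and a
triangle-free part. -/
def Partitionable (G : SimpleGraph V) : Prop :=
  ∃ B : Set V, P3FreeOn G B ∧ K3FreeOn G Bᶜ

/-- `G` contains an induced copy of `H`. -/
def HasInducedCopy {W : Type*} (H : SimpleGraph W) (G : SimpleGraph V) : Prop :=
  ∃ f : W ↪ V, ∀ a b, G.Adj (f a) (f b) ↔ H.Adj a b

/-- The diamond `K₄⁻`: the complete graph on four vertices minus the edge `01`. -/
def diamond : SimpleGraph (Fin 4) :=
  SimpleGraph.fromRel (fun a b => ¬((a = 0 ∧ b = 1) ∨ (a = 1 ∧ b = 0)))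

/-- The house: the complement of the path on five vertices. -/
def house : SimpleGraph (Fin 5) := (SimpleGraph.pathGraph 5)ᶜ

/-- The net: a triangle `012` with pendant vertices `3, 4, 5` attached to `0, 1, 2`. -/
def net : SimpleGraph (Fin 6) :=
  SimpleGraph.fromRel (fun a b =>
    (a = 0 ∧ b = 1) ∨ (a = 0 ∧ b = 2) ∨ (a = 1 ∧ b = 2) ∨
    (a = 0 ∧ b = 3) ∨ (a = 1 ∧ b = 4) ∨ (a = 2 ∧ b = 5))

theorem no_diamond (G : SimpleGraph V) (hd : ¬HasInducedCopy diamond G) (x y u v : V)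
    (hxy : x ≠ y) (h1 : G.Adj u v) (h2 : G.Adj x u) (h3 : G.Adj x v) (h4 : G.Adj y u)
    (h5 : G.Adj y v) : G.Adj x y := by
  by_contra h
  apply hd
  refine ⟨⟨![x, y, u, v], ?_⟩, ?_⟩
  · have := h1.ne
    have := h2.ne
    have := h3.ne
    have := h4.ne
    have := h5.ne
    intro i j hij
    fin_cases i <;> fin_cases j <;> simp_all
  · intro i j
    change G.Adj (![x, y, u, v] i) (![x, y, u, v] j) ↔ _
    fin_cases i <;> fin_cases j <;> simp_all [diamond, G.adj_comm]

theorem no_house (G : SimpleGraph V) (hh : ¬HasInducedCopy house G) (a b c a' b' : V)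
    (hab : G.Adj a b) (hac : G.Adj a c) (hbc : G.Adj b c)
    (ha : G.Adj a a') (hb : G.Adj b b')
    (n1 : ¬ G.Adj a' b) (n2 : ¬ G.Adj a' c) (n3 : ¬ G.Adj b' a) (n4 : ¬ G.Adj b' c) :
    ¬ G.Adj a' b' := by
  intro h
  apply hh
  have e1 := hab.symm
  have e2 := hac.symm
  have e3 := hbc.symm
  have e4 := ha.symm
  have e5 := hb.symm
  have e6 := h.symm
  have m1 : ¬ G.Adj b a' := fun t => n1 t.symm
  have m2 : ¬ G.Adj c a' := fun t => n2 t.symm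
  have m3 : ¬ G.Adj a b' := fun t => n3 t.symm
  have m4 : ¬ G.Adj c b' := fun t => n4 t.symm
  refine ⟨⟨![a, b', c, a', b], ?_⟩, ?_⟩
  · intro i j hij
    fin_cases i <;> fin_cases j <;> simp at hij ⊢ <;> subst hij <;> simp_all
  · intro i j
    change G.Adj (![a, b', c, a', b] i) (![a, b', c, a', b] j) ↔ _
    fin_cases i <;> fin_cases j <;> simp_all [house, SimpleGraph.pathGraph_adj]

theorem no_net (G : SimpleGraph V) (hn : ¬HasInducedCopy net G) (a b c a' b' c' : V)
    (hab : G.Adj a b) (hac : G.Adj a c) (hbc : G.Adj b c)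
    (ha : G.Adj a a') (hb : G.Adj b b') (hc : G.Adj c c')
    (n1 : ¬ G.Adj a' b) (n2 : ¬ G.Adj a' c) (n3 : ¬ G.Adj b' a) (n4 : ¬ G.Adj b' c)
    (n5 : ¬ G.Adj c' a) (n6 : ¬ G.Adj c' b)
    (p1 : ¬ G.Adj a' b') (p2 : ¬ G.Adj a' c') (p3 : ¬ G.Adj b' c') : False := by
  apply hn
  have e1 := hab.symm
  have e2 := hac.symm
  have e3 := hbc.symm
  have e4 := ha.symm
  have e5 := hb.symm
  have e6 := hc.symm
  have m1 : ¬ G.Adj b a' := fun t => n1 t.symm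
  have m2 : ¬ G.Adj c a' := fun t => n2 t.symm
  have m3 : ¬ G.Adj a b' := fun t => n3 t.symm
  have m4 : ¬ G.Adj c b' := fun t => n4 t.symm
  have m5 : ¬ G.Adj a c' := fun t => n5 t.symm
  have m6 : ¬ G.Adj b c' := fun t => n6 t.symm
  have q1 : ¬ G.Adj b' a' := fun t => p1 t.symm
  have q2 : ¬ G.Adj c' a' := fun t => p2 t.symm
  have q3 : ¬ G.Adj c' b' := fun t => p3 t.symm
  refine ⟨⟨![a, b, c, a', b', c'], ?_⟩, ?_⟩
  · intro i j hij
    fin_cases i <;> fin_cases j <;> simp at hij ⊢ <;> subst hij <;> simp_all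
  · intro i j
    change G.Adj (![a, b, c, a', b', c'] i) (![a, b, c, a', b', c'] j) ↔ _
    fin_cases i <;> fin_cases j <;> simp_all [net]

/-- A non-simplicial vertex `a` of a triangle has a private neighbour. -/
theorem private_nbr (G : SimpleGraph V) (hd : ¬HasInducedCopy diamond G) (a b c : V)
    (hab : G.Adj a b) (hac : G.Adj a c) (hbc : G.Adj b c)
    (ha : ¬ ∀ x y, G.Adj a x → G.Adj a y → x ≠ y → G.Adj x y) :
    ∃ a', G.Adj a a' ∧ ¬ G.Adj a' b ∧ ¬ G.Adj a' c := by
  by_contra hcon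
  push Not at hcon
  have key : ∀ x, G.Adj a x → x = b ∨ G.Adj x b := by
    intro x hx
    by_contra hx'
    push Not at hx'
    have hxc := hcon x hx hx'.2
    exact hx'.2 (no_diamond G hd x b a c hx'.1 hac hx.symm hxc hab.symm hbc)
  apply ha
  intro x y hx hy hxy
  rcases key x hx with rfl | h1
  · rcases key y hy with rfl | h2
    · exact absurd rfl hxy
    · exact h2.symm
  · rcases key y hy with rfl | h2
    · exact h1
    · exact no_diamond G hd x y a b hxy hab hx.symm h1 hy.symm h2

theorem stmt7 [Fintype V] (G : SimpleGraph V)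
    (hd : ¬HasInducedCopy diamond G) (hh : ¬HasInducedCopy house G)
    (hn : ¬HasInducedCopy net G) : Partitionable G := by
  refine ⟨{v | ∀ x y, G.Adj v x → G.Adj v y → x ≠ y → G.Adj x y}, ?_, ?_⟩
  · intro a _ b hb c _ hab hbc hac
    exact hb a c hab.symm hbc hac
  · rintro a ha b hb c hc ⟨hab, hbc, hac⟩
    obtain ⟨a', ha1, ha2, ha3⟩ := private_nbr G hd a b c hab hac hbc ha
    obtain ⟨b', hb1, hb2, hb3⟩ := private_nbr G hd b a c hab.symm hbc hac hb
    obtain ⟨c', hc1, hc2, hc3⟩ := private_nbr G hd c a b hac.symm hbc.symm hab hc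
    exact no_net G hn a b c a' b' c' hab hac hbc ha1 hb1 hc1 ha2 ha3 hb2 hb3 hc2 hc3
      (no_house G hh a b c a' b' hab hac hbc ha1 hb1 ha2 ha3 hb2 hb3)
      (no_house G hh a c b a' c' hac hab hbc.symm ha1 hc1 ha3 ha2 hc2 hc3)
      (no_house G hh b c a b' c' hbc hab.symm hac.symm hb1 hc1 hb3 hb2 hc3 hc2)
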